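/- Let q₁ = e[xx,11], q₂ = e[yy,11], r₁ = 1 − e[xy,00], r₂ = 1 − e[yx,00], all elements of L. Then: (i) q₁ ≤ r₁, q₂ ≤ r₁, q₁ ≤ r₂ and q₂ ≤ r₂ pointwise on S; (ii) r₁ and r₂ are incomparable: neither r₁ ≤ r₂ nor r₂ ≤ r₁ holds pointwise on S; (iii) every h ∈ L with q₁ ≤ h and q₂ ≤ h pointwise on S satisfies r₁ ≤ h or r₂ ≤ h. Hence the set of minimal upper bounds of {q₁, q₂} in L is exactly {r₁, r₂}, and {q₁, q₂} has no least upper bound in L. -/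

import Mathlib

namespace BoxWorld

/-- A (2,2)-box assignment: `P a b α β` stands for `P(αβ|ab)`, where the measurement
settings are `a, b ∈ Fin 2` (with `x = 0`, `y = 1`) and the outcomes are `α, β ∈ Fin 2`. -/
abbrev Box : Type := Fin 2 → Fin 2 → Fin 2 → Fin 2 → ℝ

/-- (P1) positivity, (P2) normalization, (P3) non-signalling. -/
def IsState (P : Box) : Prop :=
  (∀ a b α β, 0 ≤ P a b α β) ∧
  (∀ a b, ∑ α : Fin 2, ∑ β : Fin 2, P a b α β = 1) ∧
  (∀ a b b' α, ∑ β : Fin 2, P a b α β = ∑ β : Fin 2, P a b' α β) ∧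
  (∀ a a' b β, ∑ α : Fin 2, P a b α β = ∑ α : Fin 2, P a' b α β)

/-- The set `S` of (2,2)-box states, as a subtype. -/
abbrev State : Type := {P : Box // IsState P}

/-- The elementary question `e[ab, αβ]`, as a functional on states. -/
def elem (a b α β : Fin 2) : State → ℝ := fun P => P.1 a b α β

abbrev Idx : Type := Fin 2 × Fin 2 × Fin 2 × Fin 2

def elemI (i : Idx) : State → ℝ := elem i.1 i.2.1 i.2.2.1 i.2.2.2

/-- The logic `L` of the (2,2)-box world: all functionals `f = Σ_{e ∈ A} e`, where `A` is a
set of elementary questions whose pointwise sum is `≤ 1` at every state, together with the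
complements `1 - f` of all such functionals. -/
def InLogic (f : State → ℝ) : Prop :=
  (∃ A : Finset Idx, (∀ P : State, ∑ i ∈ A, elemI i P ≤ 1) ∧
      f = fun P => ∑ i ∈ A, elemI i P) ∨
  (∃ A : Finset Idx, (∀ P : State, ∑ i ∈ A, elemI i P ≤ 1) ∧
      f = fun P => 1 - ∑ i ∈ A, elemI i P)

/-- `q₁ = e[xx,11]`. -/
def q1 : State → ℝ := elem 0 0 1 1
/-- `q₂ = e[yy,11]`. -/
def q2 : State → ℝ := elem 1 1 1 1
/-- `r₁ = 1 − e[xy,00]`. -/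
def r1 : State → ℝ := fun P => 1 - P.1 0 1 0 0
/-- `r₂ = 1 − e[yx,00]`. -/
def r2 : State → ℝ := fun P => 1 - P.1 1 0 0 0

/-- The local deterministic state with responses `f` and `g`. -/
def detState (f g : Fin 2 → Fin 2) : State :=
  ⟨fun a b α β => if f a = α ∧ g b = β then 1 else 0, by
    refine ⟨fun a b α β => by dsimp only; split_ifs <;> norm_num, fun a b => ?_, fun a b b' α => ?_,
      fun a a' b β => ?_⟩
    · simp [ite_and]
    · simp [ite_and]
    · simp [ite_and, Finset.sum_ite_eq]⟩

lemma elemI_detState (f g : Fin 2 → Fin 2) (i : Idx) :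
    elemI i (detState f g) = if f i.1 = i.2.2.1 ∧ g i.2.1 = i.2.2.2 then 1 else 0 := rfl

lemma elemI_nonneg (i : Idx) (P : State) : 0 ≤ elemI i P := P.2.1 _ _ _ _

/-- Two elementary questions are compatible if they are equal or exclude each other locally. -/
def Compat (i j : Idx) : Prop :=
  i = j ∨ (i.1 = j.1 ∧ i.2.2.1 ≠ j.2.2.1) ∨ (i.2.1 = j.2.1 ∧ i.2.2.2 ≠ j.2.2.2)

instance : DecidableRel Compat := fun i j => by unfold Compat; infer_instance

lemma exists_response {a a' α α' : Fin 2} (h : a = a' → α = α') :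
    ∃ f : Fin 2 → Fin 2, f a = α ∧ f a' = α' := by
  by_cases ha : a = a'
  · exact ⟨fun _ => α, rfl, h ha⟩
  · exact ⟨fun c => if c = a then α else α', by simp, by simp [Ne.symm ha]⟩

/-- Distinct questions whose values sum to at most one at every state are compatible. -/
lemma compat_of_add_le_one {i j : Idx} (h : ∀ P, i ≠ j → elemI i P + elemI j P ≤ 1) :
    Compat i j := by
  by_contra hc
  simp only [Compat, not_or, not_and, not_not] at hc
  obtain ⟨hij, hA, hB⟩ := hc
  obtain ⟨f, hf, hf'⟩ := exists_response hA
  obtain ⟨g, hg, hg'⟩ := exists_response hB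
  have := h (detState f g) hij
  simp only [elemI_detState, hf, hf', hg, hg', and_self, if_true] at this
  norm_num at this

lemma compat_of_sum_le_one {A : Finset Idx} (hA : ∀ P : State, ∑ i ∈ A, elemI i P ≤ 1)
    {i j : Idx} (hi : i ∈ A) (hj : j ∈ A) : Compat i j := by
  refine compat_of_add_le_one fun P hij => ?_
  rw [← Finset.sum_pair (f := fun k => elemI k P) hij]
  refine (Finset.sum_le_sum_of_subset_of_nonneg ?_ fun k _ _ => elemI_nonneg k P).trans (hA P)
  simp [Finset.insert_subset_iff, hi, hj]

lemma exists_mem_of_one_le_sum {A : Finset Idx} {f g : Fin 2 → Fin 2}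
    (h : 1 ≤ ∑ i ∈ A, elemI i (detState f g)) : ∃ a b, (a, b, f a, g b) ∈ A := by
  have h0 : ∑ i ∈ A, elemI i (detState f g) ≠ 0 := by linarith
  obtain ⟨⟨a, b, α, β⟩, hi, hne⟩ := Finset.exists_ne_zero_of_sum_ne_zero h0
  rw [elemI_detState] at hne
  obtain ⟨rfl, rfl⟩ : f a = α ∧ g b = β := by simpa using hne
  exact ⟨a, b, hi⟩

/-- The four outcomes of a measurement in which one party measures `c` first and the other
party's setting `t` may depend on its outcome; Alice goes first iff `s = true`. -/
def adaptive (s : Bool) (c : Fin 2) (t : Fin 2 → Fin 2) (p : Fin 2 × Fin 2) : Idx :=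
  if s then (c, t p.1, p.1, p.2) else (t p.1, c, p.2, p.1)

lemma adaptive_injective (s : Bool) (c : Fin 2) (t : Fin 2 → Fin 2) :
    Function.Injective (adaptive s c t) := by
  rintro ⟨p, q⟩ ⟨p', q'⟩ h
  cases s <;> simp_all [adaptive]

lemma sum_adaptive (s : Bool) (c : Fin 2) (t : Fin 2 → Fin 2) (P : State) :
    ∑ p, elemI (adaptive s c t p) P = 1 := by
  obtain ⟨P, -, h1, hA, hB⟩ := P
  rw [Fintype.sum_prod_type]
  cases s
  · simp only [adaptive, elemI, elem, Bool.false_eq_true, if_false]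
    rw [← h1 0 c, Finset.sum_comm]
    conv_rhs => rw [Finset.sum_comm]
    rw [Finset.sum_comm]
    exact Finset.sum_congr rfl fun β _ => hB _ _ _ _
  · simp only [adaptive, elemI, elem, if_true]
    rw [← h1 c 0]
    exact Finset.sum_congr rfl fun α _ => hA _ _ _ _

lemma one_sub_le_sum {A : Finset Idx} {s : Bool} {c : Fin 2} {t : Fin 2 → Fin 2} {v : Idx}
    (h : ∀ p, adaptive s c t p = v ∨ adaptive s c t p ∈ A) (P : State) :
    1 - elemI v P ≤ ∑ i ∈ A, elemI i P := by
  have hsub : Finset.univ.map ⟨_, adaptive_injective s c t⟩ ⊆ insert v A := by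
    intro i hi
    obtain ⟨p, -, rfl⟩ := Finset.mem_map.1 hi
    exact Finset.mem_insert.2 (h p)
  have h1 := Finset.sum_le_sum_of_subset_of_nonneg hsub fun i _ _ => elemI_nonneg i P
  rw [Finset.sum_map] at h1
  have h2 : ∑ i ∈ insert v A, elemI i P ≤ elemI v P + ∑ i ∈ A, elemI i P := by
    by_cases hv : v ∈ A
    · rw [Finset.insert_eq_of_mem hv]
      linarith [elemI_nonneg v P]
    · rw [Finset.sum_insert hv]
  have h3 := sum_adaptive s c t P
  simp only [Function.Embedding.coeFn_mk] at h1
  linarith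

/-- The deterministic states at which `q₁` or `q₂` is true. -/
def coverPoints : List ((Fin 2 → Fin 2) × (Fin 2 → Fin 2)) :=
  [(![1, 1], ![1, 1]), (![1, 0], ![1, 0]), (![0, 1], ![0, 1]), (![1, 0], ![1, 1]),
   (![1, 1], ![1, 0]), (![0, 1], ![1, 1]), (![1, 1], ![0, 1])]

/-- `l` contains the outcomes of an adaptive measurement, up to `e[xy,00]` or `e[yx,00]`. -/
def ContainsAdaptive (l : List Idx) : Prop :=
  ∃ v ∈ [((0, 1, 0, 0) : Idx), (1, 0, 0, 0)], ∃ s c t, ∀ p : Fin 2 × Fin 2,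
    adaptive s c t p = v ∨ adaptive s c t p ∈ l

set_option synthInstance.maxSize 10000 in
instance : DecidablePred ContainsAdaptive := fun l => by unfold ContainsAdaptive; infer_instance

/-- Every way of extending `l` by pairwise compatible questions, one true at each of the given
deterministic states, contains an adaptive measurement. -/
def CoverForces : List ((Fin 2 → Fin 2) × (Fin 2 → Fin 2)) → List Idx → Prop
  | [], l => ContainsAdaptive l
  | d :: ds, l => ∀ a b, (∀ j ∈ l, Compat (a, b, d.1 a, d.2 b) j) →
      CoverForces ds ((a, b, d.1 a, d.2 b) :: l)

instance decidableCoverForces : ∀ ds l, Decidable (CoverForces ds l)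
  | [], l => inferInstanceAs (Decidable (ContainsAdaptive l))
  | d :: ds, l =>
    have : ∀ l, Decidable (CoverForces ds l) := decidableCoverForces ds
    inferInstanceAs (Decidable (∀ a b, (∀ j ∈ l, Compat (a, b, d.1 a, d.2 b) j) →
      CoverForces ds ((a, b, d.1 a, d.2 b) :: l)))

lemma coverForces_coverPoints : CoverForces coverPoints [] := by decide +kernel

lemma CoverForces.containsAdaptive {A : Finset Idx} (hA : ∀ i ∈ A, ∀ j ∈ A, Compat i j)
    {ds : List ((Fin 2 → Fin 2) × (Fin 2 → Fin 2))} {l : List Idx} (h : CoverForces ds l)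
    (hl : ∀ i ∈ l, i ∈ A) (hds : ∀ d ∈ ds, ∃ a b, (a, b, d.1 a, d.2 b) ∈ A) :
    ∃ l', ContainsAdaptive l' ∧ ∀ i ∈ l', i ∈ A := by
  induction ds generalizing l with
  | nil => exact ⟨l, h, hl⟩
  | cons d ds ih =>
    obtain ⟨a, b, hab⟩ := hds d List.mem_cons_self
    refine ih (h a b fun j hj => hA _ hab _ (hl j hj)) ?_
      fun d' hd' => hds d' (List.mem_cons_of_mem _ hd')
    exact List.forall_mem_cons.2 ⟨hab, hl⟩

lemma q_true_of_mem_coverPoints : ∀ d ∈ coverPoints,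
    (d.1 0 = 1 ∧ d.2 0 = 1) ∨ (d.1 1 = 1 ∧ d.2 1 = 1) := by decide

lemma upper_bound_of_sum {A : Finset Idx} (hA : ∀ P : State, ∑ i ∈ A, elemI i P ≤ 1)
    (h1 : ∀ P : State, q1 P ≤ ∑ i ∈ A, elemI i P) (h2 : ∀ P : State, q2 P ≤ ∑ i ∈ A, elemI i P) :
    (∀ P : State, r1 P ≤ ∑ i ∈ A, elemI i P) ∨ (∀ P : State, r2 P ≤ ∑ i ∈ A, elemI i P) := by
  have hcov : ∀ d ∈ coverPoints, ∃ a b, (a, b, d.1 a, d.2 b) ∈ A := by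
    rintro ⟨f, g⟩ hd
    refine exists_mem_of_one_le_sum ?_
    rcases q_true_of_mem_coverPoints _ hd with h | h
    · exact (if_pos h).symm.trans_le (h1 (detState f g))
    · exact (if_pos h).symm.trans_le (h2 (detState f g))
  obtain ⟨l, ⟨v, hv, s, c, t, h⟩, hl⟩ := coverForces_coverPoints.containsAdaptive
    (fun i hi j hj => compat_of_sum_le_one hA hi hj) (by simp) hcov
  have key := one_sub_le_sum fun p => (h p).imp_right (hl _)
  simp only [List.mem_cons, List.not_mem_nil, or_false] at hv
  rcases hv with rfl | rfl
  · exact Or.inl key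
  · exact Or.inr key

set_option synthInstance.maxSize 10000 in
lemma eq_of_compat_of_compat : ∀ i : Idx, i ≠ (0, 0, 1, 1) → i ≠ (1, 1, 1, 1) →
    Compat i (0, 0, 1, 1) → Compat i (1, 1, 1, 1) → i = (0, 1, 0, 0) ∨ i = (1, 0, 0, 0) := by
  decide

lemma upper_bound_of_one_sub_sum {A : Finset Idx} (hA : ∀ P : State, ∑ i ∈ A, elemI i P ≤ 1)
    (h1 : ∀ P : State, q1 P ≤ 1 - ∑ i ∈ A, elemI i P)
    (h2 : ∀ P : State, q2 P ≤ 1 - ∑ i ∈ A, elemI i P) :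
    (∀ P : State, r1 P ≤ 1 - ∑ i ∈ A, elemI i P) ∨
      (∀ P : State, r2 P ≤ 1 - ∑ i ∈ A, elemI i P) := by
  have key : ∀ j : Idx, j.2.2 = (1, 1) → (∀ P, elemI j P ≤ 1 - ∑ i ∈ A, elemI i P) →
      ∀ i ∈ A, i ≠ j ∧ Compat i j := by
    intro j hj h i hi
    have hadd : ∀ P, elemI i P + elemI j P ≤ 1 := fun P => by
      linarith [h P, Finset.single_le_sum (fun k _ => elemI_nonneg k P) hi]
    refine ⟨?_, compat_of_add_le_one fun P _ => hadd P⟩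
    rintro rfl
    have := hadd (detState (fun _ => 1) fun _ => 1)
    norm_num [elemI_detState, hj] at this
  have hmem : ∀ i ∈ A, i = (0, 1, 0, 0) ∨ i = (1, 0, 0, 0) := fun i hi =>
    have k1 := key (0, 0, 1, 1) rfl h1 i hi
    have k2 := key (1, 1, 1, 1) rfl h2 i hi
    eq_of_compat_of_compat i k1.1 k2.1 k1.2 k2.2
  have hle : ∀ v : Idx, (∀ i ∈ A, i = v) → ∀ P, 1 - elemI v P ≤ 1 - ∑ i ∈ A, elemI i P := by
    intro v hv P
    have := Finset.sum_le_sum_of_subset_of_nonneg (f := fun i => elemI i P)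
      (fun i hi => Finset.mem_singleton.2 (hv i hi)) fun i _ _ => elemI_nonneg i P
    rw [Finset.sum_singleton] at this
    linarith
  by_cases hv : ((0, 1, 0, 0) : Idx) ∈ A
  · refine Or.inl (hle (0, 1, 0, 0) fun i hi => (hmem i hi).resolve_right ?_)
    rintro rfl
    exact absurd (compat_of_sum_le_one hA hv hi) (by decide)
  · exact Or.inr (hle (1, 0, 0, 0) fun i hi => (hmem i hi).resolve_left fun h => hv (h ▸ hi))

lemma State.le_one (P : State) (a b α β : Fin 2) : P.1 a b α β ≤ 1 := by
  have h := P.2.2.1 a b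
  rw [← h]
  exact (Finset.single_le_sum (fun β _ => P.2.1 a b α β) (Finset.mem_univ β)).trans
    (Finset.single_le_sum (f := fun α => ∑ β, P.1 a b α β)
      (fun α _ => Finset.sum_nonneg fun β _ => P.2.1 a b α β) (Finset.mem_univ α))

lemma inLogic_elem (a b α β : Fin 2) : InLogic (elem a b α β) :=
  Or.inl ⟨{(a, b, α, β)}, fun P => by simpa [elemI, elem] using P.le_one a b α β, by simp [elemI]⟩

lemma inLogic_one_sub_elem (a b α β : Fin 2) : InLogic fun P => 1 - P.1 a b α β :=
  Or.inr ⟨{(a, b, α, β)}, fun P => by simpa [elemI, elem] using P.le_one a b α β, by simp [elemI, elem]⟩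

/-- Questions with the same setting but different outcomes for one party are exclusive. -/
lemma add_le_one_of_alice (P : State) (a b b' α α' β β' : Fin 2) (h : α ≠ α') :
    P.1 a b α β + P.1 a b' α' β' ≤ 1 := by
  have hα := Finset.single_le_sum (fun β _ => P.2.1 a b α β) (Finset.mem_univ β)
  have hα' := Finset.single_le_sum (fun β _ => P.2.1 a b' α' β) (Finset.mem_univ β')
  rw [P.2.2.2.1 a b' b] at hα'
  have hsum := P.2.2.1 a b
  have hsub := Finset.sum_le_sum_of_subset_of_nonneg (Finset.subset_univ {α, α'})
    (f := fun α => ∑ β, P.1 a b α β) fun α _ _ => Finset.sum_nonneg fun β _ => P.2.1 a b α β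
  rw [Finset.sum_pair h] at hsub
  linarith

lemma add_le_one_of_bob (P : State) (a a' b α α' β β' : Fin 2) (h : β ≠ β') :
    P.1 a b α β + P.1 a' b α' β' ≤ 1 := by
  have hβ := Finset.single_le_sum (fun α _ => P.2.1 a b α β) (Finset.mem_univ α)
  have hβ' := Finset.single_le_sum (fun α _ => P.2.1 a' b α β') (Finset.mem_univ α')
  rw [P.2.2.2.2 a' a b] at hβ'
  have hsum := P.2.2.1 a b
  rw [Finset.sum_comm] at hsum
  have hsub := Finset.sum_le_sum_of_subset_of_nonneg (Finset.subset_univ {β, β'})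
    (f := fun β => ∑ α, P.1 a b α β) fun β _ _ => Finset.sum_nonneg fun α _ => P.2.1 a b α β
  rw [Finset.sum_pair h] at hsub
  linarith

/-- `q₁, q₂, r₁, r₂ ∈ L`; (i) `r₁` and `r₂` are upper bounds of `{q₁, q₂}`;
(ii) `r₁` and `r₂` are incomparable; (iii) every upper bound `h ∈ L` of `{q₁, q₂}`
majorizes `r₁` or `r₂`. Hence the minimal upper bounds of `{q₁, q₂}` in `L` are exactly
`{r₁, r₂}`, and `{q₁, q₂}` has no least upper bound in `L`. -/
theorem minimal_upper_bounds_of_q1_q2 :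
    InLogic q1 ∧ InLogic q2 ∧ InLogic r1 ∧ InLogic r2 ∧
    ((∀ P : State, q1 P ≤ r1 P) ∧ (∀ P : State, q2 P ≤ r1 P) ∧
     (∀ P : State, q1 P ≤ r2 P) ∧ (∀ P : State, q2 P ≤ r2 P)) ∧
    ((¬ ∀ P : State, r1 P ≤ r2 P) ∧ (¬ ∀ P : State, r2 P ≤ r1 P)) ∧
    (∀ h : State → ℝ, InLogic h →
      (∀ P : State, q1 P ≤ h P) → (∀ P : State, q2 P ≤ h P) →
      (∀ P : State, r1 P ≤ h P) ∨ (∀ P : State, r2 P ≤ h P)) ∧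
    ¬ ∃ h : State → ℝ, InLogic h ∧
        (∀ P : State, q1 P ≤ h P) ∧ (∀ P : State, q2 P ≤ h P) ∧
        (∀ h' : State → ℝ, InLogic h' →
          (∀ P : State, q1 P ≤ h' P) → (∀ P : State, q2 P ≤ h' P) →
          ∀ P : State, h P ≤ h' P) := by
  have hb : (∀ P : State, q1 P ≤ r1 P) ∧ (∀ P : State, q2 P ≤ r1 P) ∧
      (∀ P : State, q1 P ≤ r2 P) ∧ (∀ P : State, q2 P ≤ r2 P) :=
    ⟨fun P => le_sub_iff_add_le.2 (add_le_one_of_alice P 0 0 1 1 0 1 0 (by decide)),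
      fun P => le_sub_iff_add_le.2 (add_le_one_of_bob P 1 0 1 1 0 1 0 (by decide)),
      fun P => le_sub_iff_add_le.2 (add_le_one_of_bob P 0 1 0 1 0 1 0 (by decide)),
      fun P => le_sub_iff_add_le.2 (add_le_one_of_alice P 1 1 0 1 0 1 0 (by decide))⟩
  have h12 : ¬ ∀ P : State, r1 P ≤ r2 P := fun h => by
    have := h (detState ![1, 0] ![0, 0])
    norm_num [r1, r2, detState] at this
  have h21 : ¬ ∀ P : State, r2 P ≤ r1 P := fun h => by
    have := h (detState ![0, 1] ![0, 0])
    norm_num [r1, r2, detState] at this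
  have hmin : ∀ h : State → ℝ, InLogic h →
      (∀ P : State, q1 P ≤ h P) → (∀ P : State, q2 P ≤ h P) →
      (∀ P : State, r1 P ≤ h P) ∨ (∀ P : State, r2 P ≤ h P) := by
    rintro h (⟨A, hA, rfl⟩ | ⟨A, hA, rfl⟩) h1 h2
    · exact upper_bound_of_sum hA h1 h2
    · exact upper_bound_of_one_sub_sum hA h1 h2
  have hr1 : InLogic r1 := inLogic_one_sub_elem 0 1 0 0
  have hr2 : InLogic r2 := inLogic_one_sub_elem 1 0 0 0
  refine ⟨inLogic_elem _ _ _ _, inLogic_elem _ _ _ _, hr1, hr2, hb, ⟨h12, h21⟩, hmin, ?_⟩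
  rintro ⟨h, hh, h1, h2, hleast⟩
  rcases hmin h hh h1 h2 with hr | hr
  · exact h12 fun P => (hr P).trans (hleast r2 hr2 hb.2.2.1 hb.2.2.2 P)
  · exact h21 fun P => (hr P).trans (hleast r1 hr1 hb.1 hb.2.1 P)

end BoxWorld
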